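/- Fix reals a < b and x ∈ ℝ, and let H : ℕ → [0,∞) be a sequence with Σ_{n≥0} H(n) < ∞. Then lim_{t→∞} √t · E_x[ H(D_t) ] = 2(b−a)·√(2/π) · ( Σ_{n≥1} H(n) + H(0)·( 1/2 + |x−b|/(2(b−a)) ) ). -/

import Mathlib

open MeasureTheory ProbabilityTheory Filter
open scoped NNReal ENNReal Topology

noncomputable section

/-- The natural filtration `F_t = σ(X_s : s ≤ t)` of a real-valued process indexed by `ℝ≥0`. -/
def natFiltration {Ω : Type*} [m : MeasurableSpace Ω] (X : ℝ≥0 → Ω → ℝ) :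
    MeasureTheory.Filtration ℝ≥0 m where
  seq t := (⨆ s ∈ Set.Iic t, MeasurableSpace.comap (X s) Real.measurableSpace) ⊓ m
  mono' := fun s t hst =>
    inf_le_inf_right m (biSup_mono fun u (hu : u ∈ Set.Iic s) => le_trans hu hst)
  le' := fun _ => inf_le_right

/-- The running supremum `S_t = sup_{0 ≤ u ≤ t} X_u` of a process indexed by `ℝ≥0`. -/
def runSup {Ω : Type*} (X : ℝ≥0 → Ω → ℝ) (t : ℝ≥0) (ω : Ω) : ℝ :=
  sSup ((fun u => X u ω) '' Set.Iic t)

/-- A real-valued process `X` indexed by `ℝ≥0` is a standard one-dimensional Brownian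
motion started at `x` under `P`. -/
structure IsBrownianMotion {Ω : Type*} [m : MeasurableSpace Ω] (P : Measure Ω)
    (X : ℝ≥0 → Ω → ℝ) (x : ℝ) : Prop where
  stronglyMeasurable : ∀ t, StronglyMeasurable (X t)
  init : ∀ᵐ ω ∂P, X 0 ω = x
  cont : ∀ᵐ ω ∂P, Continuous fun t => X t ω
  gauss_incr : ∀ s t : ℝ≥0, s ≤ t →
    P.map (fun ω => X t ω - X s ω) = gaussianReal 0 (t - s)
  indep_incr : ∀ s t : ℝ≥0, s ≤ t →
    Indep (MeasurableSpace.comap (fun ω => X t ω - X s ω) Real.measurableSpace)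
      (natFiltration X s) P

open scoped Classical in
/-- The alternating sequence of stopping times of up-crossings of `b` and
down-crossings of `a`: `σ_0 = 0`, `σ_{2n+1} = inf{t ≥ σ_{2n} : X_t > b}`,
`σ_{2n+2} = inf{t ≥ σ_{2n+1} : X_t < a}` (with `inf ∅ = ∞`). -/
noncomputable def dcSigma {Ω : Type*} (a b : ℝ) (X : ℝ≥0 → Ω → ℝ) (ω : Ω) : ℕ → ℝ≥0∞
  | 0 => 0
  | Nat.succ n =>
      sInf ((fun u : ℝ≥0 => (u : ℝ≥0∞)) ''
        {u : ℝ≥0 | dcSigma a b X ω n ≤ (u : ℝ≥0∞) ∧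
          (if Even n then b < X u ω else X u ω < a)})

/-- `D_t`, the number of down-crossings from `b` to `a` before time `t`:
the number of indices `n ≥ 1` with `σ_{2n} ≤ t`. -/
noncomputable def dcD {Ω : Type*} (a b : ℝ) (X : ℝ≥0 → Ω → ℝ) (t : ℝ≥0) (ω : Ω) : ℕ :=
  Set.ncard {n : ℕ | 1 ≤ n ∧ dcSigma a b X ω (2 * n) ≤ (t : ℝ≥0∞)}

open scoped Classical in
/-- The down-crossing martingale `M_t^{↓,G}`. -/
noncomputable def dcM {Ω : Type*} (a b : ℝ) (G : ℕ → ℝ) (X : ℝ≥0 → Ω → ℝ)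
    (t : ℝ≥0) (ω : Ω) : ℝ :=
  ∑' n : ℕ,
    ((if dcSigma a b X ω (2 * n) ≤ (t : ℝ≥0∞) ∧ (t : ℝ≥0∞) < dcSigma a b X ω (2 * n + 1)
        then G n / 2 * (1 + (b - X t ω) / (b - a)) + G (n + 1) / 2 * ((X t ω - a) / (b - a))
        else 0)
      + (if dcSigma a b X ω (2 * n + 1) ≤ (t : ℝ≥0∞) ∧
            (t : ℝ≥0∞) < dcSigma a b X ω (2 * n + 2)
        then G (n + 1) / 2 * (1 + (b - X t ω) / (b - a)) + G n / 2 * ((X t ω - a) / (b - a))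
        else 0))

/-- The levels crossed in turn: `b` at even steps and `a` at odd steps. -/
def crossLevel (a b : ℝ) (n : ℕ) : ℝ := if Even n then b else a

lemma neg_one_pow_mul_crossLevel_sub (a b : ℝ) (n : ℕ) :
    (-1 : ℝ) ^ n * (crossLevel a b n - crossLevel a b (n + 1)) = b - a := by
  rcases Nat.even_or_odd n with h | h
  · have h' : ¬ Even (n + 1) := by simpa [Nat.even_add_one] using h
    simp [crossLevel, h, h', h.neg_one_pow]
  · have h' : Even (n + 1) := h.add_one
    have h'' : ¬ Even n := by simpa using h
    simp [crossLevel, h', h'', h.neg_one_pow]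

section Path

variable {Ω : Type*} {a b : ℝ} {X : ℝ≥0 → Ω → ℝ} {ω : Ω}

lemma crossed_iff (n : ℕ) (y : ℝ) :
    (if Even n then b < y else y < a) ↔ 0 < (-1 : ℝ) ^ n * (y - crossLevel a b n) := by
  rcases Nat.even_or_odd n with h | h
  · simp [crossLevel, h, h.neg_one_pow]
  · have h'' : ¬ Even n := by simpa using h
    simp [crossLevel, h'', h.neg_one_pow]

lemma dcSigma_succ (n : ℕ) :
    dcSigma a b X ω (n + 1) = sInf ((fun u : ℝ≥0 => (u : ℝ≥0∞)) ''
      {u : ℝ≥0 | dcSigma a b X ω n ≤ (u : ℝ≥0∞) ∧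
        0 < (-1 : ℝ) ^ n * (X u ω - crossLevel a b n)}) := by
  rw [dcSigma]
  simp only [← crossed_iff]

lemma dcSigma_succ_lt_iff (n : ℕ) (s : ℝ≥0∞) :
    dcSigma a b X ω (n + 1) < s ↔ ∃ u : ℝ≥0, (u : ℝ≥0∞) < s ∧ dcSigma a b X ω n ≤ u ∧
      0 < (-1 : ℝ) ^ n * (X u ω - crossLevel a b n) := by
  rw [dcSigma_succ, sInf_lt_iff]
  constructor
  · rintro ⟨_, ⟨u, hu, rfl⟩, h⟩
    exact ⟨u, h, hu.1, hu.2⟩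
  · rintro ⟨u, h, h1, h2⟩
    exact ⟨_, ⟨u, ⟨h1, h2⟩, rfl⟩, h⟩

lemma dcSigma_le_succ (n : ℕ) : dcSigma a b X ω n ≤ dcSigma a b X ω (n + 1) := by
  rw [dcSigma_succ]
  refine le_sInf ?_
  rintro _ ⟨u, hu, rfl⟩
  exact hu.1

lemma dcSigma_mono : Monotone (dcSigma a b X ω) := monotone_nat_of_le_succ dcSigma_le_succ

lemma not_crossed_of_lt {n : ℕ} {u : ℝ≥0} (h₁ : dcSigma a b X ω n ≤ u)
    (h₂ : (u : ℝ≥0∞) < dcSigma a b X ω (n + 1)) :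
    (-1 : ℝ) ^ n * (X u ω - crossLevel a b n) ≤ 0 := by
  by_contra! h
  rw [dcSigma_succ] at h₂
  exact (not_le.2 h₂) (sInf_le ⟨u, ⟨h₁, h⟩, rfl⟩)

lemma crossed_of_eq_dcSigma (hc : Continuous fun t => X t ω) {n : ℕ} {u : ℝ≥0}
    (hu : dcSigma a b X ω (n + 1) = u) :
    0 ≤ (-1 : ℝ) ^ n * (X u ω - crossLevel a b n) := by
  by_contra! h
  have hopen : IsOpen {v : ℝ≥0 | (-1 : ℝ) ^ n * (X v ω - crossLevel a b n) < 0} :=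
    isOpen_lt (by fun_prop) continuous_const
  obtain ⟨w, hw, hwsub⟩ := exists_Ico_subset_of_mem_nhds (hopen.mem_nhds h) (exists_gt u)
  obtain ⟨v, hv, hle, hvc⟩ := (dcSigma_succ_lt_iff n (w : ℝ≥0∞)).1 (by rw [hu]; exact_mod_cast hw)
  rcases lt_or_ge v u with hvu | hvu
  · have : dcSigma a b X ω (n + 1) ≤ v := by
      rw [dcSigma_succ]; exact sInf_le ⟨v, ⟨hle, hvc⟩, rfl⟩
    rw [hu] at this
    exact absurd (by exact_mod_cast this) (not_le.2 hvu)
  · exact absurd hvc (not_lt.2 (le_of_lt (hwsub ⟨hvu, by exact_mod_cast hv⟩)))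

lemma eq_crossLevel_of_lt (hc : Continuous fun t => X t ω) {n : ℕ} {u : ℝ≥0}
    (hu : dcSigma a b X ω (n + 1) = u) (hlt : dcSigma a b X ω n < u) :
    X u ω = crossLevel a b n := by
  have h₁ := crossed_of_eq_dcSigma hc hu
  obtain ⟨w, hw⟩ := ENNReal.lt_iff_exists_coe.1 hlt
  have hwu : w < u := by rw [hw.1] at hlt; exact_mod_cast hlt
  have h₂ : (-1 : ℝ) ^ n * (X u ω - crossLevel a b n) ≤ 0 := by
    have hcl : u ∈ closure (Set.Ioo w u) := by
      rw [closure_Ioo hwu.ne]; exact ⟨hwu.le, le_rfl⟩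
    refine closure_minimal (t := {v | (-1 : ℝ) ^ n * (X v ω - crossLevel a b n) ≤ 0}) ?_
      (isClosed_le (by fun_prop) continuous_const) hcl
    intro v hv
    refine not_crossed_of_lt (n := n) ?_ ?_
    · rw [hw.1]; exact_mod_cast hv.1.le
    · rw [hu]; exact_mod_cast hv.2
  have h₃ := le_antisymm h₂ h₁
  simpa [sub_eq_zero] using h₃

/-- At its first passage the path sits at `b`, or at its starting point if this exceeds `b`. -/
lemma apply_dcSigma_one (hc : Continuous fun t => X t ω) {u : ℝ≥0}
    (hu : dcSigma a b X ω 1 = u) : X u ω = max b (X 0 ω) := by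
  rcases eq_or_ne u 0 with rfl | h0
  · have h := crossed_of_eq_dcSigma (n := 0) hc hu
    simp [crossLevel] at h
    simp [h]
  · have h₁ := eq_crossLevel_of_lt (n := 0) hc hu (by
      simpa [dcSigma] using h0.bot_lt)
    have h₂ := not_crossed_of_lt (a := a) (b := b) (X := X) (ω := ω) (n := 0) (u := 0)
      (by simp [dcSigma]) (by rw [hu]; simpa using h0.bot_lt)
    simp [crossLevel] at h₁ h₂
    simp [h₁, h₂]

lemma apply_dcSigma_add_two (hab : a < b) (hc : Continuous fun t => X t ω) {n : ℕ} {u : ℝ≥0}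
    (hu : dcSigma a b X ω (n + 2) = u) : X u ω = crossLevel a b (n + 1) := by
  refine eq_crossLevel_of_lt hc hu (lt_of_le_of_ne (hu ▸ dcSigma_le_succ _) fun h => ?_)
  have h₁ := crossed_of_eq_dcSigma hc h
  have h₂ := crossed_of_eq_dcSigma hc hu
  have h₃ := neg_one_pow_mul_crossLevel_sub a b n
  rw [pow_succ] at h₂
  linarith

/-- The path obtained from `X` by reflecting it at each of the first `n` crossing times. -/
def unfolded (a b : ℝ) (X : ℝ≥0 → Ω → ℝ) (n : ℕ) (t : ℝ≥0) (ω : Ω) : ℝ :=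
  X t ω - X 0 ω + ∑ k ∈ Finset.range n,
    2 * (-1 : ℝ) ^ (k + 1) * (X t ω - X (min (t : ℝ≥0∞) (dcSigma a b X ω (k + 1))).toNNReal ω)

lemma unfolded_succ (n : ℕ) (t : ℝ≥0) : unfolded a b X (n + 1) t ω = unfolded a b X n t ω +
    2 * (-1 : ℝ) ^ (n + 1) *
      (X t ω - X (min (t : ℝ≥0∞) (dcSigma a b X ω (n + 1))).toNNReal ω) := by
  simp [unfolded, Finset.sum_range_succ, add_assoc]

lemma unfolded_succ_of_lt {n : ℕ} {t : ℝ≥0} (h : (t : ℝ≥0∞) < dcSigma a b X ω (n + 1)) :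
    unfolded a b X (n + 1) t ω = unfolded a b X n t ω := by
  simp [unfolded_succ, min_eq_left h.le]

lemma unfolded_succ_of_ge (hab : a < b) (hc : Continuous fun t => X t ω) {n : ℕ} {t : ℝ≥0}
    (h : dcSigma a b X ω (n + 1) ≤ t) :
    unfolded a b X (n + 1) t ω = |X 0 ω - b| + n * (b - a) +
      (-1 : ℝ) ^ (n + 1) * (X t ω - crossLevel a b n) := by
  obtain ⟨u, hu⟩ : ∃ u : ℝ≥0, dcSigma a b X ω (n + 1) = u :=
    ⟨_, (ENNReal.coe_toNNReal (h.trans_lt ENNReal.coe_lt_top).ne).symm⟩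
  induction n generalizing u with
  | zero =>
    rw [unfolded_succ, min_eq_right h, hu, ENNReal.toNNReal_coe, apply_dcSigma_one hc hu]
    simp only [unfolded, crossLevel]
    rcases le_total b (X 0 ω) with h0 | h0
    · rw [max_eq_right h0, abs_of_nonneg (by linarith)]; simp; ring
    · rw [max_eq_left h0, abs_of_nonpos (by linarith)]; simp; ring
  | succ n ih =>
    have h' := (dcSigma_le_succ (n + 1)).trans h
    have hf : dcSigma a b X ω (n + 1) ≠ ∞ := (h'.trans_lt ENNReal.coe_lt_top).ne
    rw [unfolded_succ, ih h' _ (ENNReal.coe_toNNReal hf).symm, min_eq_right h, hu,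
      ENNReal.toNNReal_coe, apply_dcSigma_add_two hab hc hu]
    have h₃ := neg_one_pow_mul_crossLevel_sub a b n
    push_cast
    rw [pow_succ, pow_succ]
    linear_combination h₃

lemma unfolded_le_of_lt (hab : a < b) (hc : Continuous fun t => X t ω) {n : ℕ} {t : ℝ≥0}
    (h : (t : ℝ≥0∞) < dcSigma a b X ω (n + 1)) :
    unfolded a b X n t ω ≤ |X 0 ω - b| + n * (b - a) := by
  induction n with
  | zero =>
    have h₂ := not_crossed_of_lt (n := 0) (by simp [dcSigma]) h
    have := neg_abs_le (X 0 ω - b)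
    simp [crossLevel] at h₂
    simp [unfolded]
    linarith
  | succ n ih =>
    push_cast
    rcases lt_or_ge (t : ℝ≥0∞) (dcSigma a b X ω (n + 1)) with h' | h'
    · rw [unfolded_succ_of_lt h']
      linarith [ih h']
    · rw [unfolded_succ_of_ge hab hc h']
      have h₂ := not_crossed_of_lt h' h
      have h₃ := neg_one_pow_mul_crossLevel_sub a b n
      rw [pow_succ] at h₂ ⊢
      linarith

lemma unfolded_add_unfolded_of_ge (hab : a < b) (hc : Continuous fun t => X t ω) {n : ℕ} {t : ℝ≥0}
    (h : dcSigma a b X ω (n + 2) ≤ t) :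
    unfolded a b X (n + 2) t ω + unfolded a b X (n + 1) t ω =
      2 * (|X 0 ω - b| + (n + 1) * (b - a)) := by
  rw [unfolded_succ_of_ge hab hc h, unfolded_succ_of_ge hab hc ((dcSigma_le_succ _).trans h)]
  have h₃ := neg_one_pow_mul_crossLevel_sub a b n
  push_cast
  rw [pow_succ, pow_succ]
  linear_combination h₃

end Path
/-- Multiplying a centred Gaussian increment by a sign known beforehand preserves its law. -/
lemma integral_cexp_add_sign_mul {Ω : Type*} {m₁ m : MeasurableSpace Ω} {P : Measure Ω}
    [IsProbabilityMeasure P] (hm₁ : m₁ ≤ m)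
    {W ε Δ : Ω → ℝ} {v : ℝ≥0} (hW : Measurable[m₁] W) (hε : Measurable[m₁] ε)
    (hε' : ∀ ω, ε ω = 1 ∨ ε ω = -1) (hΔ : Measurable[m] Δ) (hΔlaw : P.map Δ = gaussianReal 0 v)
    (hind : Indep (MeasurableSpace.comap Δ Real.measurableSpace) m₁ P) (u : ℝ) :
    ∫ ω, Complex.exp (u * (W ω + ε ω * Δ ω : ℝ) * Complex.I) ∂P =
      (∫ ω, Complex.exp (u * (W ω : ℝ) * Complex.I) ∂P) *
        Complex.exp (-(v * u ^ 2 / 2)) := by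
  have hWm := hW.mono hm₁ le_rfl
  have hεm := hε.mono hm₁ le_rfl
  have hbound : ∀ ω, ‖(1 + ε ω) / 2‖ ≤ 1 ∧ ‖(1 - ε ω) / 2‖ ≤ 1 := fun ω => by
    rcases hε' ω with h | h <;> norm_num [h]
  have hchar : ∀ c : ℝ, c ^ 2 = u ^ 2 → ∫ ω, Complex.exp (c * (Δ ω : ℝ) * Complex.I) ∂P =
      Complex.exp (-(v * u ^ 2 / 2)) := fun c hc => by
    have h := charFun_gaussianReal (μ := 0) (v := v) c
    rw [← hΔlaw, charFun_apply_real, integral_map hΔ.aemeasurable (by fun_prop)] at h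
    rw [h]
    congr 1
    rw [← Complex.ofReal_pow, ← Complex.ofReal_pow, ← hc]
    push_cast
    ring
  have key : ∀ c : ℝ, c ^ 2 = u ^ 2 → ∀ g : Ω → ℝ, Measurable[m₁] g →
      ∫ ω, (Complex.exp (u * (W ω : ℝ) * Complex.I) * (g ω : ℝ)) *
        Complex.exp (c * (Δ ω : ℝ) * Complex.I) ∂P =
      (∫ ω, Complex.exp (u * (W ω : ℝ) * Complex.I) * (g ω : ℝ) ∂P) *
        Complex.exp (-(v * u ^ 2 / 2)) := by
    intro c hc g hg
    rw [← hchar c hc]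
    have hgm := hg.mono hm₁ le_rfl
    have hm : Measurable[m₁]
        (fun ω => Complex.exp (u * (W ω : ℝ) * Complex.I) * (g ω : ℝ)) := by fun_prop
    have hi : IndepFun (fun ω => Complex.exp (u * (W ω : ℝ) * Complex.I) * (g ω : ℝ))
        (fun ω => Complex.exp (c * (Δ ω : ℝ) * Complex.I)) P := by
      rw [IndepFun_iff_Indep]
      refine indep_of_indep_of_le (hind.symm) (measurable_iff_comap_le.1 hm) ?_
      have : Measurable[MeasurableSpace.comap Δ Real.measurableSpace] Δ := comap_measurable Δ
      exact measurable_iff_comap_le.1 (by fun_prop)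
    exact hi.integral_fun_mul_eq_mul_integral (hm.mono hm₁ le_rfl).aestronglyMeasurable
      (by fun_prop)
  have hinteg : ∀ g h : Ω → ℝ, Measurable[m] g → (∀ ω, ‖g ω‖ ≤ 1) → Measurable[m] h →
      Integrable (fun ω => (Complex.exp (u * (W ω : ℝ) * Complex.I) * (g ω : ℝ)) *
        Complex.exp ((h ω : ℝ) * Complex.I)) P := by
    intro g h hg hg1 hh
    refine Integrable.of_bound (by fun_prop) 1 (ae_of_all _ fun ω => ?_)
    rw [norm_mul, norm_mul, Complex.norm_exp_ofReal_mul_I, ← Complex.ofReal_mul,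
      Complex.norm_exp_ofReal_mul_I, Complex.norm_real]
    simpa using hg1 ω
  have hsplit : ∀ ω, Complex.exp (u * (W ω + ε ω * Δ ω : ℝ) * Complex.I) =
      (Complex.exp (u * (W ω : ℝ) * Complex.I) * ((1 + ε ω) / 2 : ℝ)) *
        Complex.exp (u * (Δ ω : ℝ) * Complex.I) +
      (Complex.exp (u * (W ω : ℝ) * Complex.I) * ((1 - ε ω) / 2 : ℝ)) *
        Complex.exp ((-u : ℝ) * (Δ ω : ℝ) * Complex.I) := fun ω => by
    rcases hε' ω with h | h <;> rw [h] <;> norm_num <;> rw [← Complex.exp_add] <;> congr 1 <;> ring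
  simp_rw [hsplit]
  rw [integral_add, key u rfl _ (by fun_prop), key (-u) (by ring) _ (by fun_prop), ← add_mul,
    ← integral_add]
  · congr 2
    ext ω
    push_cast
    ring
  · simpa using hinteg _ 0 (by fun_prop) (fun ω => (hbound ω).1) measurable_zero
  · simpa using hinteg _ 0 (by fun_prop) (fun ω => (hbound ω).2) measurable_zero
  · simpa using hinteg _ (fun ω => u * Δ ω) (by fun_prop) (fun ω => (hbound ω).1) (by fun_prop)
  · simpa using hinteg _ (fun ω => -u * Δ ω) (by fun_prop) (fun ω => (hbound ω).2) (by fun_prop)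


section Transform

variable {Ω : Type*} [m : MeasurableSpace Ω] {P : Measure Ω} {X : ℝ≥0 → Ω → ℝ} {x : ℝ}

lemma measurable_natFiltration (hX : ∀ t, StronglyMeasurable (X t)) {s t : ℝ≥0} (hst : s ≤ t) :
    Measurable[natFiltration X t] (X s) := by
  rw [measurable_iff_comap_le]
  refine le_inf ?_ (measurable_iff_comap_le.1 (hX s).measurable)
  exact le_iSup₂_of_le (f := fun s (_ : s ∈ Set.Iic t) =>
    MeasurableSpace.comap (X s) Real.measurableSpace) s hst le_rfl

lemma natFiltration_le (t : ℝ≥0) : (natFiltration X t : MeasurableSpace Ω) ≤ m :=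
  (natFiltration X).le t

/-- A discrete stochastic integral of a predictable sign process against Brownian motion is
Gaussian, with the same law as the increment of the Brownian motion. -/
lemma IsBrownianMotion.map_sum_sign_mul [IsProbabilityMeasure P] (hX : IsBrownianMotion P X x)
    {τ : ℕ → ℝ≥0} (hτ : Monotone τ) {ε : ℕ → Ω → ℝ}
    (hε : ∀ j, Measurable[natFiltration X (τ j)] (ε j)) (hε' : ∀ j ω, ε j ω = 1 ∨ ε j ω = -1)
    (N : ℕ) :
    P.map (fun ω => ∑ j ∈ Finset.range N, ε j ω * (X (τ (j + 1)) ω - X (τ j) ω)) =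
      gaussianReal 0 (τ N - τ 0) := by
  have hWm : ∀ N, Measurable[natFiltration X (τ N)]
      (fun ω => ∑ j ∈ Finset.range N, ε j ω * (X (τ (j + 1)) ω - X (τ j) ω)) := by
    intro N
    refine Finset.measurable_fun_sum _ fun j hj => ?_
    have hj' : j + 1 ≤ N := Finset.mem_range.1 hj
    refine ((hε j).mono ((natFiltration X).mono (hτ (by omega))) le_rfl).mul
      (Measurable.sub ?_ ?_)
    · exact measurable_natFiltration hX.stronglyMeasurable (hτ hj')
    · exact measurable_natFiltration hX.stronglyMeasurable (hτ (by omega))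
  have hXm : ∀ t, Measurable (X t) := fun t => (hX.stronglyMeasurable t).measurable
  have hWm' := fun N => (hWm N).mono (natFiltration_le (τ N)) le_rfl
  have := Measure.isProbabilityMeasure_map (μ := P) (hWm' N).aemeasurable
  refine Measure.ext_of_charFun (funext fun u => ?_)
  rw [charFun_gaussianReal, charFun_apply_real,
    integral_map (hWm' N).aemeasurable (by fun_prop)]
  clear this
  induction N with
  | zero => simp
  | succ N ih =>
    simp_rw [Finset.sum_range_succ]
    rw [integral_cexp_add_sign_mul (Δ := fun ω => X (τ (N + 1)) ω - X (τ N) ω)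
      (natFiltration_le (τ N)) (hWm N) (hε N) (hε' N) ((hXm _).sub (hXm _))
      (hX.gauss_incr _ _ (hτ (Nat.le_succ N)))
      (hX.indep_incr _ _ (hτ (Nat.le_succ N))), ih, ← Complex.exp_add]
    congr 1
    rw [NNReal.coe_sub (hτ (Nat.zero_le _)), NNReal.coe_sub (hτ (Nat.zero_le _)),
      NNReal.coe_sub (hτ (Nat.le_succ _))]
    push_cast
    ring

/-- An almost sure limit of random variables with a common law has this law too. -/
lemma map_eq_of_tendsto_ae [IsProbabilityMeasure P] {W : ℕ → Ω → ℝ} {Y : Ω → ℝ}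
    {μ : Measure ℝ} [IsProbabilityMeasure μ] (hW : ∀ n, Measurable (W n))
    (hlaw : ∀ᶠ n in atTop, P.map (W n) = μ)
    (hlim : ∀ᵐ ω ∂P, Tendsto (fun n => W n ω) atTop (𝓝 (Y ω))) :
    P.map Y = μ := by
  have hY : AEMeasurable Y P :=
    aemeasurable_of_tendsto_metrizable_ae atTop (fun n => (hW n).aemeasurable) hlim
  have := Measure.isProbabilityMeasure_map (μ := P) hY
  refine Measure.ext_of_charFun (funext fun u => ?_)
  rw [charFun_apply_real, integral_map hY (by fun_prop)]
  refine tendsto_nhds_unique (f := fun n => ∫ ω, Complex.exp (u * (W n ω) * Complex.I) ∂P)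
    (l := atTop) ?_ ?_
  · refine tendsto_integral_of_dominated_convergence (fun _ => 1) (fun n => ?_)
      (integrable_const _) (fun n => ae_of_all _ fun ω => ?_) ?_
    · have := hW n
      fun_prop
    · rw [← Complex.ofReal_mul, Complex.norm_exp_ofReal_mul_I]
    · filter_upwards [hlim] with ω hω
      exact ((by fun_prop : Continuous fun y : ℝ =>
        Complex.exp (u * y * Complex.I)).tendsto _).comp hω
  · refine tendsto_const_nhds.congr' ?_
    filter_upwards [hlaw] with n hn
    rw [← hn, charFun_apply_real, integral_map (hW n).aemeasurable (by fun_prop)]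

end Transform

section Crossing

variable {Ω : Type*} {a b : ℝ} {X : ℝ≥0 → Ω → ℝ} {ω : Ω}

/-- The event that `n` crossings are completed strictly before time `s`, as witnessed at times in
a countable dense set. -/
def crossedBefore (a b : ℝ) (X : ℝ≥0 → Ω → ℝ) : ℕ → ℝ≥0 → Set Ω
  | 0, _ => Set.univ
  | n + 1, s => ⋃ i : {i : ℕ // TopologicalSpace.denseSeq ℝ≥0 i < s},
      crossedBefore a b X n (TopologicalSpace.denseSeq ℝ≥0 i) ∩
        {ω | 0 < (-1 : ℝ) ^ n * (X (TopologicalSpace.denseSeq ℝ≥0 i) ω - crossLevel a b n)}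

lemma measurableSet_crossedBefore [m : MeasurableSpace Ω] (hX : ∀ t, StronglyMeasurable (X t))
    (n : ℕ) (s : ℝ≥0) : MeasurableSet[natFiltration X s] (crossedBefore a b X n s) := by
  induction n generalizing s with
  | zero => exact MeasurableSet.univ
  | succ n ih =>
    refine MeasurableSet.iUnion fun i => MeasurableSet.inter
      ((natFiltration X).mono i.2.le _ (ih _)) ?_
    have := measurable_natFiltration hX i.2.le
    have hg : Measurable[natFiltration X s] (fun ω =>
        (-1 : ℝ) ^ n * (X (TopologicalSpace.denseSeq ℝ≥0 i) ω - crossLevel a b n)) := by fun_prop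
    exact hg measurableSet_Ioi

lemma mem_crossedBefore_iff (hc : Continuous fun t => X t ω) (n : ℕ) (s : ℝ≥0) :
    ω ∈ crossedBefore a b X (n + 1) s ↔ dcSigma a b X ω (n + 1) < s := by
  suffices h : ∀ n s, (ω ∈ crossedBefore a b X n s → dcSigma a b X ω n ≤ s) ∧
      (dcSigma a b X ω n < s → ω ∈ crossedBefore a b X n s) by
    refine ⟨fun hω => ?_, (h _ s).2⟩
    obtain ⟨i, h₁, h₂⟩ := Set.mem_iUnion.1 hω
    exact (dcSigma_succ_lt_iff n s).2 ⟨_, by exact_mod_cast i.2, (h n _).1 h₁, h₂⟩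
  intro n
  induction n with
  | zero => intro s; simp [dcSigma, crossedBefore]
  | succ n ih =>
    intro s
    refine ⟨fun hω => ?_, fun hs => ?_⟩
    · obtain ⟨i, h₁, h₂⟩ := Set.mem_iUnion.1 hω
      exact ((dcSigma_succ_lt_iff n s).2 ⟨_, by exact_mod_cast i.2, (ih _).1 h₁, h₂⟩).le
    · obtain ⟨u, hus, hu, hcross⟩ := (dcSigma_succ_lt_iff n s).1 hs
      have hopen : IsOpen {v : ℝ≥0 | 0 < (-1 : ℝ) ^ n * (X v ω - crossLevel a b n)} :=
        isOpen_lt continuous_const (by fun_prop)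
      have hus' : u < s := by exact_mod_cast hus
      obtain ⟨w, hw, hwsub⟩ := exists_Ico_subset_of_mem_nhds (hopen.mem_nhds hcross) ⟨s, hus'⟩
      obtain ⟨i, hi₁, hi₂⟩ := (TopologicalSpace.denseRange_denseSeq ℝ≥0).exists_mem_open
        (isOpen_Ioo (a := u) (b := min w s)) (Set.nonempty_Ioo.2 (lt_min hw hus'))
      exact Set.mem_iUnion.2 ⟨⟨i, hi₂.trans_le (min_le_right _ _)⟩,
        (ih _).2 (hu.trans_lt (by exact_mod_cast hi₁)),
        hwsub ⟨hi₁.le, hi₂.trans_le (min_le_left _ _)⟩⟩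

/-- The sign of the increments of `unfolded a b X n` at time `s`. -/
def crossSign (a b : ℝ) (X : ℝ≥0 → Ω → ℝ) (n : ℕ) (s : ℝ≥0) (ω : Ω) : ℝ :=
  1 + ∑ k ∈ Finset.range n,
    2 * (-1 : ℝ) ^ (k + 1) * (crossedBefore a b X (k + 1) s).indicator 1 ω

lemma crossedBefore_mono {n : ℕ} : Monotone (crossedBefore a b X n) := by
  intro s t hst
  cases n with
  | zero => exact le_rfl
  | succ n =>
    refine Set.iUnion_subset fun i => ?_
    exact Set.subset_iUnion_of_subset ⟨i, i.2.trans_le hst⟩ le_rfl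

lemma crossedBefore_succ_subset (n : ℕ) (s : ℝ≥0) :
    crossedBefore a b X (n + 1) s ⊆ crossedBefore a b X n s :=
  Set.iUnion_subset fun i => Set.inter_subset_left.trans (crossedBefore_mono i.2.le)

lemma crossSign_succ (n : ℕ) (s : ℝ≥0) : crossSign a b X (n + 1) s ω = crossSign a b X n s ω +
    2 * (-1 : ℝ) ^ (n + 1) * (crossedBefore a b X (n + 1) s).indicator 1 ω := by
  simp [crossSign, Finset.sum_range_succ, add_assoc]

lemma crossSign_of_mem {n : ℕ} {s : ℝ≥0} (h : ω ∈ crossedBefore a b X n s) :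
    crossSign a b X n s ω = (-1) ^ n := by
  induction n with
  | zero => simp [crossSign]
  | succ n ih =>
    rw [crossSign_succ, ih (crossedBefore_succ_subset _ _ h), Set.indicator_of_mem h, pow_succ]
    simp
    ring

lemma crossSign_eq (n : ℕ) (s : ℝ≥0) (ω : Ω) :
    crossSign a b X n s ω = 1 ∨ crossSign a b X n s ω = -1 := by
  induction n with
  | zero => simp [crossSign]
  | succ n ih =>
    by_cases h : ω ∈ crossedBefore a b X (n + 1) s
    · rw [crossSign_of_mem h]
      exact neg_one_pow_eq_or ℝ (n + 1)
    · simpa [crossSign_succ, Set.indicator_of_notMem h] using ih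

lemma measurable_crossSign [m : MeasurableSpace Ω] (hX : ∀ t, StronglyMeasurable (X t))
    (n : ℕ) (s : ℝ≥0) : Measurable[natFiltration X s] (crossSign a b X n s) := by
  refine Measurable.add measurable_const (Finset.measurable_fun_sum _ fun k _ => ?_)
  exact (measurable_const.indicator (measurableSet_crossedBefore hX _ _)).const_mul _

/-- The sum over a grid of mesh `h` of the increments of `f` after time `u`. -/
lemma exists_sum_indicator_mul_eq (f : ℝ≥0 → ℝ) (h u : ℝ≥0) (N : ℕ) :
    ∃ r : ℝ≥0, ∑ j ∈ Finset.range N, (if u < j * h then (1 : ℝ) else 0) *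
      (f ((j + 1 : ℕ) * h) - f (j * h)) = f (N * h) - f r ∧
      min (N * h) u ≤ r ∧ r ≤ min (N * h) u + h := by
  suffices H : ∃ r : ℝ≥0, ∑ j ∈ Finset.range N, (if u < j * h then (1 : ℝ) else 0) *
      (f ((j + 1 : ℕ) * h) - f (j * h)) = f (N * h) - f r ∧
      min (N * h) u ≤ r ∧ r ≤ min (N * h) u + h ∧ (N * h ≤ u → r = N * h) by
    obtain ⟨r, h₁, h₂, h₃, -⟩ := H
    exact ⟨r, h₁, h₂, h₃⟩
  induction N with
  | zero => exact ⟨0, by simp⟩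
  | succ N ih =>
    obtain ⟨r, h₁, h₂, h₃, h₄⟩ := ih
    have hN : ((N + 1 : ℕ) : ℝ≥0) * h = N * h + h := by push_cast; ring
    rcases lt_or_ge u (N * h) with hu | hu
    · have hu' : u < (N + 1 : ℕ) * h := hN ▸ hu.trans_le le_self_add
      refine ⟨r, ?_, ?_, ?_, fun hle => absurd hle (not_le.2 hu')⟩
      · rw [Finset.sum_range_succ, h₁]; simp [hu]
      · rwa [min_eq_right hu'.le, ← min_eq_right hu.le]
      · rwa [min_eq_right hu'.le, ← min_eq_right hu.le]
    · refine ⟨(N + 1 : ℕ) * h, ?_, min_le_left _ _, ?_, fun _ => rfl⟩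
      · rw [Finset.sum_range_succ, h₁, h₄ hu]; simp [not_lt.2 hu]
      · rw [hN]
        gcongr
        exact le_min le_self_add hu

lemma tendsto_sum_indicator_mul {f : ℝ≥0 → ℝ} (hf : Continuous f) (t u : ℝ≥0) :
    Tendsto (fun N : ℕ => ∑ j ∈ Finset.range N, (if u < j * (t / N) then (1 : ℝ) else 0) *
      (f ((j + 1 : ℕ) * (t / N)) - f (j * (t / N)))) atTop (𝓝 (f t - f (min t u))) := by
  choose r hr₁ hr₂ hr₃ using fun N : ℕ => exists_sum_indicator_mul_eq f (t / N) u N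
  have hN : ∀ᶠ N : ℕ in atTop, (N : ℝ≥0) * (t / N) = t := by
    filter_upwards [eventually_ne_atTop 0] with N hN
    field_simp
  have hlim : Tendsto r atTop (𝓝 (min t u)) := by
    refine tendsto_of_tendsto_of_tendsto_of_le_of_le' (h := fun N : ℕ => min t u + t / N)
      tendsto_const_nhds ?_ ?_ ?_
    · simpa using tendsto_const_nhds.add (tendsto_const_div_atTop_nhds_zero_nat t)
    · filter_upwards [hN] with N hN
      simpa [hN] using hr₂ N
    · filter_upwards [hN] with N hN
      simpa [hN] using hr₃ N
  refine (tendsto_const_nhds.sub ((hf.tendsto _).comp hlim)).congr' ?_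
  filter_upwards [hN] with N hN
  rw [hr₁, hN]
  rfl

lemma tendsto_sum_crossSign_mul (hc : Continuous fun t => X t ω) (n : ℕ) (t : ℝ≥0) :
    Tendsto (fun N : ℕ => ∑ j ∈ Finset.range N, crossSign a b X n (j * (t / N)) ω *
      (X ((j + 1 : ℕ) * (t / N)) ω - X (j * (t / N)) ω)) atTop (𝓝 (unfolded a b X n t ω)) := by
  induction n with
  | zero =>
    refine tendsto_const_nhds.congr' ?_
    filter_upwards [eventually_ne_atTop 0] with N hN
    have := Finset.sum_range_sub (fun j : ℕ => X (j * (t / N)) ω) N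
    simp only [crossSign, unfolded, Finset.range_zero, Finset.sum_empty, add_zero, one_mul, this]
    rw [mul_div_cancel₀ _ (by exact_mod_cast hN)]
    simp
  | succ n ih =>
    set σ := (min (t : ℝ≥0∞) (dcSigma a b X ω (n + 1))).toNNReal with hσ
    have hσt : (σ : ℝ≥0∞) = min (t : ℝ≥0∞) (dcSigma a b X ω (n + 1)) :=
      ENNReal.coe_toNNReal (ne_top_of_le_ne_top ENNReal.coe_ne_top (min_le_left _ _))
    have hle : σ ≤ t := by
      rw [← ENNReal.coe_le_coe, hσt]; exact min_le_left _ _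
    have key := ((tendsto_sum_indicator_mul hc t σ).const_mul (2 * (-1 : ℝ) ^ (n + 1)))
    rw [unfolded_succ, ← hσ]
    rw [min_eq_right hle] at key
    refine (ih.add key).congr fun N => ?_
    rw [Finset.mul_sum, ← Finset.sum_add_distrib]
    refine Finset.sum_congr rfl fun j hj => ?_
    have hjt : (j : ℝ≥0) * (t / N) ≤ t := by
      have hj' : (j : ℝ≥0) ≤ N := by exact_mod_cast (Finset.mem_range.1 hj).le
      calc (j : ℝ≥0) * (t / N) ≤ N * (t / N) := by gcongr
        _ = t := mul_div_cancel₀ _ (by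
          have := Finset.mem_range.1 hj
          exact_mod_cast (by omega : N ≠ 0))
    have hiff : ω ∈ crossedBefore a b X (n + 1) (j * (t / N)) ↔ σ < j * (t / N) := by
      rw [mem_crossedBefore_iff hc, ← ENNReal.coe_lt_coe, hσt, min_lt_iff]
      have : ¬ (t : ℝ≥0∞) < ((j * (t / N) : ℝ≥0) : ℝ≥0∞) := not_lt.2 (by exact_mod_cast hjt)
      tauto
    rw [crossSign_succ]
    by_cases h : σ < j * (t / N)
    · rw [Set.indicator_of_mem (hiff.2 h), if_pos h, Pi.one_apply]; ring
    · rw [Set.indicator_of_notMem (mt hiff.1 h), if_neg h]; ring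

end Crossing

section Law

variable {Ω : Type*} [m : MeasurableSpace Ω] {P : Measure Ω} [IsProbabilityMeasure P]
  {a b x : ℝ} {X : ℝ≥0 → Ω → ℝ}

/-- Reflecting a Brownian motion at successive crossing times leaves its marginals unchanged. -/
lemma IsBrownianMotion.map_unfolded (hX : IsBrownianMotion P X x) (n : ℕ) (t : ℝ≥0) :
    P.map (unfolded a b X n t) = gaussianReal 0 t := by
  have hXm : ∀ t, Measurable (X t) := fun t => (hX.stronglyMeasurable t).measurable
  refine map_eq_of_tendsto_ae (W := fun (N : ℕ) ω => ∑ j ∈ Finset.range N,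
    crossSign a b X n (j * (t / N)) ω * (X ((j + 1 : ℕ) * (t / N)) ω - X (j * (t / N)) ω))
    (fun N => Finset.measurable_fun_sum _ fun j _ => ?_) ?_ ?_
  · exact ((measurable_crossSign hX.stronglyMeasurable n _).mono (natFiltration_le _) le_rfl).mul
      ((hXm _).sub (hXm _))
  · filter_upwards [eventually_ne_atTop 0] with N hN
    have hmono : Monotone fun j : ℕ => (j : ℝ≥0) * (t / N) := fun i j hij => by
      dsimp only
      gcongr
    rw [hX.map_sum_sign_mul hmono (fun j => measurable_crossSign hX.stronglyMeasurable n _)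
      (fun j => crossSign_eq n _), mul_div_cancel₀ _ (by exact_mod_cast hN)]
    simp
  · filter_upwards [hX.cont] with ω hω using tendsto_sum_crossSign_mul hω n t

lemma IsBrownianMotion.aemeasurable_unfolded (hX : IsBrownianMotion P X x) (n : ℕ) (t : ℝ≥0) :
    AEMeasurable (unfolded a b X n t) P := by
  refine AEMeasurable.of_map_ne_zero ?_
  rw [hX.map_unfolded n t]
  exact IsProbabilityMeasure.ne_zero _

/-- Up to null sets, the `n + 2`-nd crossing occurs before `t` exactly when one of the two paths
that differ by a reflection at this crossing ends up above the level reached there. -/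
lemma IsBrownianMotion.dcSigma_le_ae_eq (hX : IsBrownianMotion P X x) (hab : a < b) (n : ℕ)
    {t : ℝ≥0} (ht : t ≠ 0) :
    {ω | dcSigma a b X ω (n + 2) ≤ t} =ᵐ[P]
      (unfolded a b X (n + 2) t ⁻¹' Set.Ioi (|x - b| + (n + 1) * (b - a)) ∪
        unfolded a b X (n + 1) t ⁻¹' Set.Ioi (|x - b| + (n + 1) * (b - a)) : Set Ω) := by
  set c := |x - b| + (n + 1) * (b - a)
  have hne : ∀ᵐ ω ∂P, unfolded a b X (n + 2) t ω ≠ c := by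
    have := nullSingletonClass_gaussianReal (μ := 0) ht
    have h : ∀ᵐ y ∂(P.map (unfolded a b X (n + 2) t)), y ≠ c := by
      rw [hX.map_unfolded]
      exact Measure.ae_ne _ _
    exact ae_of_ae_map (hX.aemeasurable_unfolded _ _) h
  filter_upwards [hX.cont, hX.init, hne] with ω hc h0 hne
  refine propext ?_
  change dcSigma a b X ω (n + 2) ≤ t ↔
    c < unfolded a b X (n + 2) t ω ∨ c < unfolded a b X (n + 1) t ω
  rcases lt_or_ge (t : ℝ≥0∞) (dcSigma a b X ω (n + 2)) with h | h
  · have h₁ := unfolded_le_of_lt hab hc h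
    rw [h0] at h₁
    push_cast at h₁
    rw [unfolded_succ_of_lt h]
    simp [not_le.2 h, c, h₁]
  · have h₁ := unfolded_add_unfolded_of_ge hab hc h
    rw [h0] at h₁
    refine ⟨fun _ => ?_, fun _ => h⟩
    by_contra! h'
    exact hne (le_antisymm h'.1 (by linarith [h'.2]))

lemma IsBrownianMotion.measureReal_dcSigma_le (hX : IsBrownianMotion P X x) (hab : a < b) (n : ℕ)
    {t : ℝ≥0} (ht : t ≠ 0) :
    P.real {ω | dcSigma a b X ω (n + 2) ≤ t} =
      2 * (gaussianReal 0 t).real (Set.Ioi (|x - b| + (n + 1) * (b - a))) := by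
  have hY := fun n => hX.aemeasurable_unfolded (a := a) (b := b) n t
  rw [measureReal_congr (hX.dcSigma_le_ae_eq hab n ht), measureReal_union₀]
  · rw [two_mul]
    congr 1 <;>
    rw [← hX.map_unfolded (a := a) (b := b) _ t,
      map_measureReal_apply_of_aemeasurable (hY _) measurableSet_Ioi]
  · exact (hY _).nullMeasurable measurableSet_Ioi
  · have h : ∀ᵐ ω ∂P, ¬ (|x - b| + (n + 1) * (b - a) < unfolded a b X (n + 2) t ω ∧
        |x - b| + (n + 1) * (b - a) < unfolded a b X (n + 1) t ω) := by
      filter_upwards [hX.cont, hX.init] with ω hc h0 ⟨h₁, h₂⟩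
      rcases lt_or_ge (t : ℝ≥0∞) (dcSigma a b X ω (n + 2)) with h | h
      · have h₃ := unfolded_le_of_lt hab hc h
        rw [h0] at h₃
        push_cast at h₃
        linarith
      · have h₃ := unfolded_add_unfolded_of_ge hab hc h
        rw [h0] at h₃
        linarith
    exact measure_mono_null (fun ω hω => not_not.2 hω) (ae_iff.1 h)

end Law

section Asymptotics

/-- The total distance that has to be covered from `x` to complete `n` down-crossings. -/
def downcrossDist (a b x : ℝ) : ℕ → ℝ
  | 0 => 0
  | n + 1 => |x - b| + (2 * n + 1) * (b - a)

lemma gaussianReal_real_Ioi_zero {t : ℝ≥0} (ht : t ≠ 0) :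
    2 * (gaussianReal 0 t).real (Set.Ioi 0) = 1 := by
  have hsymm : (gaussianReal 0 t).real (Set.Iio 0) = (gaussianReal 0 t).real (Set.Ioi 0) := by
    conv_lhs => rw [← neg_zero (G := ℝ), ← gaussianReal_map_neg, neg_zero]
    rw [map_measureReal_apply measurable_neg measurableSet_Iio]
    congr 1
    ext y
    simp
  have := nullSingletonClass_gaussianReal (μ := 0) ht
  have h := probReal_add_probReal_compl (μ := gaussianReal 0 t) (measurableSet_Ioi (a := (0 : ℝ)))
  rw [Set.compl_Ioi, measureReal_congr Iio_ae_eq_Iic.symm, hsymm] at h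
  linarith

lemma tendsto_gaussianReal_real_Ioi (t : ℝ≥0) :
    Tendsto (fun c => (gaussianReal 0 t).real (Set.Ioi c)) atTop (𝓝 0) := by
  have h := (tendsto_cdf_atTop (gaussianReal 0 t)).const_sub 1
  rw [sub_self] at h
  refine h.congr fun c => ?_
  rw [cdf_eq_real, ← Set.compl_Iic, probReal_compl_eq_one_sub measurableSet_Iic]

lemma sqrt_mul_gaussianReal_real_Ioc {t : ℝ≥0} (ht : t ≠ 0) {u v : ℝ} (huv : u ≤ v) :
    √t * (2 * (gaussianReal 0 t).real (Set.Ioc u v)) =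
      √(2 / Real.pi) * ∫ y in u..v, Real.exp (-y ^ 2 / (2 * t)) := by
  have ht' : (0 : ℝ) < t := by exact_mod_cast ht.bot_lt
  rw [measureReal_def, gaussianReal_apply_eq_integral _ ht, ENNReal.toReal_ofReal
    (setIntegral_nonneg measurableSet_Ioc fun _ _ => gaussianPDFReal_nonneg _ _ _),
    ← intervalIntegral.integral_of_le huv, gaussianPDFReal_def]
  simp only [sub_zero]
  rw [intervalIntegral.integral_const_mul, ← mul_assoc, ← mul_assoc]
  congr 1
  have hpi := Real.pi_pos
  rw [Real.sqrt_mul (by positivity), Real.sqrt_mul (by positivity), Real.sqrt_div (by positivity)]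
  have h2 := Real.mul_self_sqrt (show (0 : ℝ) ≤ 2 by norm_num)
  field_simp
  nlinarith

lemma norm_integral_exp_neg_sq_le {t : ℝ≥0} {u v : ℝ} (huv : u ≤ v) :
    ‖∫ y in u..v, Real.exp (-y ^ 2 / (2 * t))‖ ≤ v - u := by
  have h := intervalIntegral.norm_integral_le_of_norm_le_const (a := u) (b := v) (C := 1)
    (f := fun y => Real.exp (-y ^ 2 / (2 * t))) fun y _ => ?_
  · rwa [one_mul, abs_of_nonneg (by linarith)] at h
  · rw [Real.norm_of_nonneg (Real.exp_pos _).le, Real.exp_le_one_iff]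
    exact div_nonpos_of_nonpos_of_nonneg (by nlinarith [sq_nonneg y]) (by positivity)

lemma tendsto_integral_exp_neg_sq (u v : ℝ) :
    Tendsto (fun t : ℝ≥0 => ∫ y in u..v, Real.exp (-y ^ 2 / (2 * t))) atTop (𝓝 (v - u)) := by
  have h : v - u = ∫ _ in u..v, (1 : ℝ) := by simp
  rw [h]
  refine intervalIntegral.tendsto_integral_filter_of_dominated_convergence (fun _ => 1)
    (Eventually.of_forall fun t => by fun_prop) (Eventually.of_forall fun t => ae_of_all _
      fun y _ => ?_) (by simp) (ae_of_all _ fun y _ => ?_)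
  · rw [Real.norm_of_nonneg (Real.exp_pos _).le, Real.exp_le_one_iff]
    exact div_nonpos_of_nonpos_of_nonneg (by nlinarith [sq_nonneg y]) (by positivity)
  · rw [← Real.exp_zero]
    refine (Real.continuous_exp.tendsto 0).comp ?_
    exact tendsto_const_nhds.div_atTop
      ((NNReal.tendsto_coe_atTop.2 tendsto_id).const_mul_atTop two_pos)

variable {Ω : Type*} {a b x : ℝ} {X : ℝ≥0 → Ω → ℝ} {ω : Ω}

lemma monotone_downcrossDist (hab : a < b) : Monotone (downcrossDist a b x) := by
  refine monotone_nat_of_le_succ fun n => ?_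
  have := abs_nonneg (x - b)
  cases n with
  | zero => simp only [downcrossDist]; push_cast; linarith
  | succ n => simp only [downcrossDist]; push_cast; linarith

lemma downcrossDist_succ_sub_le (hab : a < b) (n : ℕ) :
    downcrossDist a b x (n + 1) - downcrossDist a b x n ≤ |x - b| + 2 * (b - a) := by
  have := abs_nonneg (x - b)
  cases n with
  | zero => simp only [downcrossDist]; push_cast; linarith
  | succ n => simp only [downcrossDist]; push_cast; linarith

lemma tendsto_downcrossDist (hab : a < b) : Tendsto (downcrossDist a b x) atTop atTop := by
  rw [← tendsto_add_atTop_iff_nat 1]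
  refine tendsto_atTop_add_const_left _ _ (Tendsto.atTop_mul_const (sub_pos.2 hab) ?_)
  exact tendsto_atTop_add_const_right _ _
    (tendsto_natCast_atTop_atTop.const_mul_atTop two_pos)

lemma dcD_eq_of_mem {n : ℕ} {t : ℝ≥0} (h₁ : dcSigma a b X ω (2 * n) ≤ t)
    (h₂ : t < dcSigma a b X ω (2 * (n + 1))) : dcD a b X t ω = n := by
  have h : {k : ℕ | 1 ≤ k ∧ dcSigma a b X ω (2 * k) ≤ (t : ℝ≥0∞)} = Finset.Icc 1 n := by
    ext k
    simp only [Set.mem_ofPred_eq, Finset.coe_Icc, Set.mem_Icc, and_congr_right_iff]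
    refine fun _ => ⟨fun hk => ?_, fun hk => (dcSigma_mono (by omega)).trans h₁⟩
    by_contra! hlt
    exact absurd (hk.trans_lt h₂) (not_lt.2 (dcSigma_mono (by omega)))
  rw [dcD, h, Set.ncard_coe_finset, Nat.card_Icc, Nat.add_sub_cancel]

lemma exists_dcSigma_le_lt {N : ℕ} {t : ℝ≥0} (h : t < dcSigma a b X ω (2 * N)) :
    ∃ n, dcSigma a b X ω (2 * n) ≤ t ∧ t < dcSigma a b X ω (2 * (n + 1)) := by
  induction N with
  | zero => simp [dcSigma] at h
  | succ N ih =>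
    rcases lt_or_ge (t : ℝ≥0∞) (dcSigma a b X ω (2 * N)) with h' | h'
    · exact ih h'
    · exact ⟨N, h', h⟩

variable [m : MeasurableSpace Ω] {P : Measure Ω} [IsProbabilityMeasure P]

lemma IsBrownianMotion.measureReal_dcSigma_two_mul_le (hX : IsBrownianMotion P X x) (hab : a < b)
    (n : ℕ) {t : ℝ≥0} (ht : t ≠ 0) : P.real {ω | dcSigma a b X ω (2 * n) ≤ t} =
      2 * (gaussianReal 0 t).real (Set.Ioi (downcrossDist a b x n)) := by
  cases n with
  | zero => simp [dcSigma, downcrossDist, gaussianReal_real_Ioi_zero ht]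
  | succ n =>
    have h := hX.measureReal_dcSigma_le hab (2 * n) ht
    push_cast at h
    exact h

lemma IsBrownianMotion.nullMeasurableSet_dcSigma_two_mul_le (hX : IsBrownianMotion P X x)
    (hab : a < b) (n : ℕ) {t : ℝ≥0} (ht : t ≠ 0) :
    NullMeasurableSet {ω | dcSigma a b X ω (2 * n) ≤ t} P := by
  cases n with
  | zero => simp [dcSigma]
  | succ n =>
    refine NullMeasurableSet.congr ?_ (hX.dcSigma_le_ae_eq hab (2 * n) ht).symm
    exact ((hX.aemeasurable_unfolded _ _).nullMeasurable measurableSet_Ioi).union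
      ((hX.aemeasurable_unfolded _ _).nullMeasurable measurableSet_Ioi)

lemma IsBrownianMotion.ae_exists_lt_dcSigma (hX : IsBrownianMotion P X x) (hab : a < b)
    {t : ℝ≥0} (ht : t ≠ 0) : ∀ᵐ ω ∂P, ∃ N, t < dcSigma a b X ω (2 * N) := by
  rw [ae_iff, ← measureReal_eq_zero_iff]
  refine le_antisymm (ge_of_tendsto (((tendsto_gaussianReal_real_Ioi t).comp
    (tendsto_downcrossDist (x := x) hab)).const_mul 2) (Eventually.of_forall fun n => ?_) |>.trans
    (mul_zero _).le) measureReal_nonneg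
  rw [Function.comp_apply, ← hX.measureReal_dcSigma_two_mul_le hab n ht]
  refine measureReal_mono fun ω hω => ?_
  simp only [Set.mem_ofPred_eq, not_exists, not_lt] at hω
  exact hω n

lemma IsBrownianMotion.dcD_eq_ae_eq (hX : IsBrownianMotion P X x) (hab : a < b) (n : ℕ)
    {t : ℝ≥0} (ht : t ≠ 0) :
    dcD a b X t ⁻¹' {n} =ᵐ[P]
      ({ω | dcSigma a b X ω (2 * n) ≤ t} \ {ω | dcSigma a b X ω (2 * (n + 1)) ≤ t} : Set Ω) := by
  filter_upwards [hX.ae_exists_lt_dcSigma hab ht] with ω ⟨N, hN⟩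
  obtain ⟨k, hk₁, hk₂⟩ := exists_dcSigma_le_lt hN
  refine propext ⟨fun h => ?_, fun h => dcD_eq_of_mem h.1 (not_le.1 h.2)⟩
  have hkn : k = n := (dcD_eq_of_mem hk₁ hk₂).symm.trans h
  subst hkn
  exact ⟨hk₁, not_le.2 hk₂⟩

lemma IsBrownianMotion.aemeasurable_dcD (hX : IsBrownianMotion P X x) (hab : a < b)
    {t : ℝ≥0} (ht : t ≠ 0) : AEMeasurable (dcD a b X t) P := by
  refine NullMeasurable.aemeasurable fun s _ => ?_
  rw [← Set.biUnion_preimage_singleton]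
  refine NullMeasurableSet.biUnion s.to_countable fun n _ => ?_
  exact ((hX.nullMeasurableSet_dcSigma_two_mul_le hab n ht).diff
    (hX.nullMeasurableSet_dcSigma_two_mul_le hab (n + 1) ht)).congr (hX.dcD_eq_ae_eq hab n ht).symm

lemma IsBrownianMotion.measureReal_dcD_eq (hX : IsBrownianMotion P X x) (hab : a < b) (n : ℕ)
    {t : ℝ≥0} (ht : t ≠ 0) : P.real (dcD a b X t ⁻¹' {n}) =
      2 * (gaussianReal 0 t).real
        (Set.Ioc (downcrossDist a b x n) (downcrossDist a b x (n + 1))) := by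
  have hd : downcrossDist a b x n ≤ downcrossDist a b x (n + 1) :=
    monotone_downcrossDist hab n.le_succ
  have hsub : {ω | dcSigma a b X ω (2 * (n + 1)) ≤ t} ⊆ {ω | dcSigma a b X ω (2 * n) ≤ t} :=
    fun ω hω => (dcSigma_mono (by omega)).trans hω
  have h₁ := measureReal_inter_add_sdiff₀ (s := {ω | dcSigma a b X ω (2 * n) ≤ t})
    (hX.nullMeasurableSet_dcSigma_two_mul_le hab (n + 1) ht)
  rw [Set.inter_eq_right.2 hsub,
    hX.measureReal_dcSigma_two_mul_le hab _ ht, hX.measureReal_dcSigma_two_mul_le hab _ ht] at h₁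
  have h₂ := measureReal_inter_add_sdiff₀ (μ := gaussianReal 0 t)
    (s := Set.Ioi (downcrossDist a b x n))
    (measurableSet_Ioi (a := downcrossDist a b x (n + 1))).nullMeasurableSet
  rw [Set.inter_eq_right.2 (Set.Ioi_subset_Ioi hd), Set.Ioi_sdiff_Ioi] at h₂
  rw [measureReal_congr (hX.dcD_eq_ae_eq hab n ht)]
  linarith

/-- The law of the number of down-crossings, integrated against `H`. -/
lemma IsBrownianMotion.sqrt_mul_integral_dcD (hX : IsBrownianMotion P X x) (hab : a < b)
    {H : ℕ → ℝ} (hH : Summable H) {t : ℝ≥0} (ht : t ≠ 0) :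
    √t * ∫ ω, H (dcD a b X t ω) ∂P = ∑' n, H n * (√(2 / Real.pi) *
      ∫ y in (downcrossDist a b x n)..(downcrossDist a b x (n + 1)),
        Real.exp (-y ^ 2 / (2 * t))) := by
  have hD := hX.aemeasurable_dcD hab ht
  have := Measure.isProbabilityMeasure_map hD
  obtain ⟨C, hC⟩ := hH.tendsto_atTop_zero.norm.bddAbove_range
  have hinteg : Integrable H (P.map (dcD a b X t)) :=
    Integrable.of_bound (by fun_prop) C (ae_of_all _ fun n => hC ⟨n, rfl⟩)
  rw [← integral_map (f := H) hD (by fun_prop), integral_countable hinteg, ← tsum_mul_left]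
  refine tsum_congr fun n => ?_
  rw [map_measureReal_apply_of_aemeasurable hD (measurableSet_singleton n),
    hX.measureReal_dcD_eq hab n ht, ← sqrt_mul_gaussianReal_real_Ioc ht
      (monotone_downcrossDist hab n.le_succ), smul_eq_mul]
  ring

end Asymptotics

/-- Asymptotics for the number of down-crossings: if `Σ H(n) < ∞` then
`√t · E_x[H(D_t)] → 2(b-a)√(2/π) (Σ_{n≥1} H(n) + H(0)(1/2 + |x-b|/(2(b-a))))`. -/
theorem downcrossing_asymptotics
    {Ω : Type*} [m : MeasurableSpace Ω] (P : Measure Ω) [IsProbabilityMeasure P]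
    (a b : ℝ) (hab : a < b) (x : ℝ)
    (X : ℝ≥0 → Ω → ℝ) (hX : IsBrownianMotion P X x)
    (H : ℕ → ℝ) (hHnonneg : ∀ n, 0 ≤ H n) (hHsum : Summable H) :
    Tendsto (fun t : ℝ≥0 => Real.sqrt t * ∫ ω, H (dcD a b X t ω) ∂P) atTop
      (nhds (2 * (b - a) * Real.sqrt (2 / Real.pi) *
        ((∑' n : ℕ, H (n + 1)) + H 0 * (1 / 2 + |x - b| / (2 * (b - a)))))) := by
  have hterm : ∀ n, Tendsto (fun t : ℝ≥0 => H n * (√(2 / Real.pi) *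
      ∫ y in (downcrossDist a b x n)..(downcrossDist a b x (n + 1)),
        Real.exp (-y ^ 2 / (2 * t)))) atTop (nhds (H n * (√(2 / Real.pi) *
          (downcrossDist a b x (n + 1) - downcrossDist a b x n)))) :=
    fun n => ((tendsto_integral_exp_neg_sq _ _).const_mul _).const_mul _
  have hle : ∀ n, downcrossDist a b x n ≤ downcrossDist a b x (n + 1) :=
    fun n => monotone_downcrossDist hab n.le_succ
  have hbound : ∀ (t : ℝ≥0) n, ‖H n * (√(2 / Real.pi) *
      ∫ y in (downcrossDist a b x n)..(downcrossDist a b x (n + 1)),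
        Real.exp (-y ^ 2 / (2 * t)))‖ ≤
      H n * (√(2 / Real.pi) * (|x - b| + 2 * (b - a))) := fun t n => by
    rw [norm_mul, norm_mul, Real.norm_of_nonneg (hHnonneg n),
      Real.norm_of_nonneg (Real.sqrt_nonneg _)]
    have h₁ := (norm_integral_exp_neg_sq_le (t := t) (hle n)).trans
      (downcrossDist_succ_sub_le hab n)
    exact mul_le_mul_of_nonneg_left (mul_le_mul_of_nonneg_left h₁ (Real.sqrt_nonneg _))
      (hHnonneg n)
  have hlim := tendsto_tsum_of_dominated_convergence (hHsum.mul_right _) hterm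
    (Eventually.of_forall hbound)
  have hval : ∑' n, H n * (√(2 / Real.pi) *
      (downcrossDist a b x (n + 1) - downcrossDist a b x n)) =
      2 * (b - a) * Real.sqrt (2 / Real.pi) *
        ((∑' n : ℕ, H (n + 1)) + H 0 * (1 / 2 + |x - b| / (2 * (b - a)))) := by
    have hsucc : ∀ n, H (n + 1) * (√(2 / Real.pi) *
        (downcrossDist a b x (n + 1 + 1) - downcrossDist a b x (n + 1))) =
        H (n + 1) * (√(2 / Real.pi) * (2 * (b - a))) := fun n => by
      simp only [downcrossDist]
      push_cast
      ring
    have hsummable : Summable fun n => H n * (√(2 / Real.pi) *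
        (downcrossDist a b x (n + 1) - downcrossDist a b x n)) := by
      rw [← summable_nat_add_iff 1]
      simp_rw [hsucc]
      exact ((summable_nat_add_iff 1).2 hHsum).mul_right _
    rw [hsummable.tsum_eq_zero_add]
    simp_rw [hsucc]
    rw [tsum_mul_right]
    simp only [downcrossDist]
    have : b - a ≠ 0 := (sub_pos.2 hab).ne'
    push_cast
    field_simp
    ring
  rw [← hval]
  refine hlim.congr' ?_
  filter_upwards [eventually_ne_atTop 0] with t ht
  exact (hX.sqrt_mul_integral_dcD hab hHsum ht).symm

end
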